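/- Let x be an ap-chain recurrent point lying in M_1. Then the closure of its ap-basic class satisfies closure([x]_ap) ⊆ M_0 ∪ [x]_ap. In particular, if closure([x]_ap) ⊆ M_1, then [x]_ap is closed. -/

import Mathlib

open MeasureTheory ProbabilityTheory Metric Set Filter Topology
open scoped ENNReal NNReal

noncomputable section

namespace QSDPaper

variable {d : ℕ}

/-- An absorption-preserving (ap) `δ`-pseudoorbit `ξ_0, …, ξ_n` in `M`. -/
def IsApOrbit (F : (Fin d → ℝ) → Fin d → ℝ) (M M0 : Set (Fin d → ℝ)) (δ : ℝ)
    (n : ℕ) (ξ : ℕ → Fin d → ℝ) : Prop :=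
  1 ≤ n ∧ (∀ i ≤ n, ξ i ∈ M) ∧ (∀ i < n, ξ i ∈ M0 → ξ (i + 1) ∈ M0) ∧
    ∀ i < n, dist (ξ (i + 1)) (F (ξ i)) < δ

/-- `x <_ap y`: for every `δ > 0` there is an ap `δ`-pseudoorbit joining `x` to `y`. -/
def apLe (F : (Fin d → ℝ) → Fin d → ℝ) (M M0 : Set (Fin d → ℝ)) (x y : Fin d → ℝ) : Prop :=
  ∀ δ > (0 : ℝ), ∃ n ξ, IsApOrbit F M M0 δ n ξ ∧ ξ 0 = x ∧ ξ n = y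

/-- `x ∼_ap y`. -/
def apEquiv (F : (Fin d → ℝ) → Fin d → ℝ) (M M0 : Set (Fin d → ℝ)) (x y : Fin d → ℝ) : Prop :=
  apLe F M M0 x y ∧ apLe F M M0 y x

/-- The set `R_ap` of ap-chain recurrent points. -/
def apRec (F : (Fin d → ℝ) → Fin d → ℝ) (M M0 : Set (Fin d → ℝ)) : Set (Fin d → ℝ) :=
  {x | apEquiv F M M0 x x}

/-- The ap-basic class of `x`. -/
def apClass (F : (Fin d → ℝ) → Fin d → ℝ) (M M0 : Set (Fin d → ℝ)) (x : Fin d → ℝ) :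
    Set (Fin d → ℝ) :=
  {y | y ∈ apRec F M M0 ∧ apEquiv F M M0 x y}

/-- `[x]_ap` is a maximal ap-basic class. -/
def IsApQuasiattractor (F : (Fin d → ℝ) → Fin d → ℝ) (M M0 : Set (Fin d → ℝ))
    (x : Fin d → ℝ) : Prop :=
  x ∈ apRec F M M0 ∧ ∀ y ∈ apRec F M M0, apLe F M M0 x y → apEquiv F M M0 x y

/-- A compact set `A` is an attractor for `F : M → M`. -/
def IsAttractor (F : (Fin d → ℝ) → Fin d → ℝ) (M A : Set (Fin d → ℝ)) : Prop :=
  IsCompact A ∧ A ⊆ M ∧ ∃ U : Set (Fin d → ℝ), IsOpen U ∧ A ⊆ U ∧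
    (⋂ n ∈ {k : ℕ | 1 ≤ k}, F^[n] '' (U ∩ M)) = A ∧
    ∀ V : Set (Fin d → ℝ), IsOpen V → A ⊆ V → ∃ N : ℕ, ∀ n ≥ N, F^[n] '' (U ∩ M) ⊆ V

/-- The ω-limit set of `x` under `F`. -/
def omegaSet (F : (Fin d → ℝ) → Fin d → ℝ) (x : Fin d → ℝ) : Set (Fin d → ℝ) :=
  {y | ∃ φ : ℕ → ℕ, StrictMono φ ∧ Tendsto (fun k => F^[φ k] x) atTop (𝓝 y)}

/-- The nonwandering set of `F` on `M`. -/
def nonwanderingSet (F : (Fin d → ℝ) → Fin d → ℝ) (M : Set (Fin d → ℝ)) :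
    Set (Fin d → ℝ) :=
  {x ∈ M | ∀ U : Set (Fin d → ℝ), IsOpen U → x ∈ U → ∀ N : ℕ,
    ∃ n ≥ N, ((F^[n] '' (U ∩ M)) ∩ (U ∩ M)).Nonempty}

/-- `β_δ(ε) = sup_{x ∈ M} p^ε(x, M \ N^δ(F x))`. -/
def beta (p : ℝ → Kernel (Fin d → ℝ) (Fin d → ℝ)) (F : (Fin d → ℝ) → Fin d → ℝ)
    (M : Set (Fin d → ℝ)) (δ ε : ℝ) : ℝ≥0∞ :=
  ⨆ x ∈ M, p ε x (M \ ball (F x) δ)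

/-- `μ` is a quasi-stationary distribution for `κ` on `M1` with eigenvalue `lam ∈ (0,1)`. -/
def IsQSD (κ : Kernel (Fin d → ℝ) (Fin d → ℝ)) (M1 : Set (Fin d → ℝ))
    (μ : Measure (Fin d → ℝ)) (lam : ℝ) : Prop :=
  IsProbabilityMeasure μ ∧ μ M1 = 1 ∧ 0 < lam ∧ lam < 1 ∧
    ∀ Γ : Set (Fin d → ℝ), MeasurableSet Γ → Γ ⊆ M1 →
      ∫⁻ x in M1, κ x Γ ∂μ = ENNReal.ofReal lam * μ Γ

/-- Weak* convergence of a sequence of measures (tested against bounded continuous functions). -/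
def WeaklyTendsto (μs : ℕ → Measure (Fin d → ℝ)) (μ : Measure (Fin d → ℝ)) : Prop :=
  ∀ g : BoundedContinuousFunction (Fin d → ℝ) ℝ,
    Tendsto (fun n => ∫ x, g x ∂μs n) atTop (𝓝 (∫ x, g x ∂μ))

/-- `stayProb κ V n x = P_x[X_0, …, X_n ∈ V] = P_x[τ_V > n]` for the Markov chain with
transition kernel `κ` started at `x`, where `τ_V = min {n : X_n ∉ V}`. -/
def stayProb (κ : Kernel (Fin d → ℝ) (Fin d → ℝ)) (V : Set (Fin d → ℝ)) :
    ℕ → (Fin d → ℝ) → ℝ≥0∞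
  | 0, x => V.indicator 1 x
  | n + 1, x => V.indicator (fun z => ∫⁻ y, stayProb κ V n y ∂κ z) x

/-- `tubeProb κ η n ξ x = P_x[dist (X_j, ξ_j) < η for j = 1, …, n]` for the Markov chain
with transition kernel `κ` started at `x`. -/
def tubeProb (κ : Kernel (Fin d → ℝ) (Fin d → ℝ)) (η : ℝ) :
    ℕ → (ℕ → Fin d → ℝ) → (Fin d → ℝ) → ℝ≥0∞
  | 0, _, _ => 1
  | n + 1, ξ, x => ∫⁻ y in ball (ξ 1) η, tubeProb κ η n (fun k => ξ (k + 1)) y ∂κ x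

/-- `A_n(ξ) = Σ_{i<n} ρ(ξ_i, ξ_{i+1})`. -/
def rhoCost (ρ : (Fin d → ℝ) → (Fin d → ℝ) → ℝ≥0∞) (n : ℕ) (ξ : ℕ → Fin d → ℝ) : ℝ≥0∞ :=
  ∑ i ∈ Finset.range n, ρ (ξ i) (ξ (i + 1))

/-- `B_ρ(x,y)`: minimal cost of a finite path in `M` from `x` to `y`. -/
def Brho (ρ : (Fin d → ℝ) → (Fin d → ℝ) → ℝ≥0∞) (M : Set (Fin d → ℝ))
    (x y : Fin d → ℝ) : ℝ≥0∞ :=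
  ⨅ (n : ℕ) (_ : 1 ≤ n) (ξ : ℕ → Fin d → ℝ)
    (_ : (∀ i ≤ n, ξ i ∈ M) ∧ ξ 0 = x ∧ ξ n = y), rhoCost ρ n ξ

/-- `x <_ρ y`. -/
def rhoLe (ρ : (Fin d → ℝ) → (Fin d → ℝ) → ℝ≥0∞) (M : Set (Fin d → ℝ))
    (x y : Fin d → ℝ) : Prop :=
  Brho ρ M x y = 0

/-- `x ∼_ρ y`. -/
def rhoEquiv (ρ : (Fin d → ℝ) → (Fin d → ℝ) → ℝ≥0∞) (M : Set (Fin d → ℝ))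
    (x y : Fin d → ℝ) : Prop :=
  rhoLe ρ M x y ∧ rhoLe ρ M y x

/-- The ρ-chain recurrent set `R_ρ`. -/
def rhoRec (ρ : (Fin d → ℝ) → (Fin d → ℝ) → ℝ≥0∞) (M : Set (Fin d → ℝ)) :
    Set (Fin d → ℝ) :=
  {x | rhoEquiv ρ M x x}

/-- The ρ-basic class of `x`. -/
def rhoClass (ρ : (Fin d → ℝ) → (Fin d → ℝ) → ℝ≥0∞) (M : Set (Fin d → ℝ))
    (x : Fin d → ℝ) : Set (Fin d → ℝ) :=
  {y | y ∈ rhoRec ρ M ∧ rhoEquiv ρ M x y}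

/-- `[x]_ρ` is a maximal ρ-basic class. -/
def IsRhoQuasiattractor (ρ : (Fin d → ℝ) → (Fin d → ℝ) → ℝ≥0∞) (M : Set (Fin d → ℝ))
    (x : Fin d → ℝ) : Prop :=
  x ∈ rhoRec ρ M ∧ ∀ y ∈ rhoRec ρ M, rhoLe ρ M x y → rhoEquiv ρ M x y

/-- Properties (i)–(iii) of Hypothesis 2.4 for the rate function `ρ`. -/
def HypRho (F : (Fin d → ℝ) → Fin d → ℝ) (M M0 : Set (Fin d → ℝ))
    (ρ : (Fin d → ℝ) → (Fin d → ℝ) → ℝ≥0∞) : Prop :=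
  ContinuousOn (fun q : (Fin d → ℝ) × (Fin d → ℝ) => ρ q.1 q.2) ((M \ M0) ×ˢ M) ∧
  (∀ x ∈ M, ∀ y ∈ M, (ρ x y = 0 ↔ y = F x)) ∧
  (∀ β : ℝ, 0 < β → ∃ c : ℝ≥0∞, 0 < c ∧ ∀ x ∈ M, ∀ y ∈ M, β < dist (F x) y → c ≤ ρ x y)

/-- Property (iv) of Hypothesis 2.4: large deviation upper and lower bounds. -/
def HypLD (p : ℝ → Kernel (Fin d → ℝ) (Fin d → ℝ)) (F : (Fin d → ℝ) → Fin d → ℝ)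
    (M M0 : Set (Fin d → ℝ)) (ρ : (Fin d → ℝ) → (Fin d → ℝ) → ℝ≥0∞) : Prop :=
  (∀ K : Set (Fin d → ℝ), IsCompact K → K ⊆ M \ M0 → ∀ z : Fin d → ℝ, ∀ r > (0 : ℝ),
    ∀ η > (0 : ℝ), ∀ᶠ ε : ℝ in 𝓝[>] (0 : ℝ), ∀ x ∈ K,
      -(((⨅ y ∈ ball z r ∩ M, ρ x y : ℝ≥0∞) : EReal)) - (η : EReal)
        ≤ (ε : EReal) * ENNReal.log (p ε x (ball z r ∩ M))) ∧
  (∀ C : Set (Fin d → ℝ), IsClosed C → C ⊆ M → ∀ η > (0 : ℝ),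
    ∀ᶠ ε : ℝ in 𝓝[>] (0 : ℝ), ∀ x ∈ M,
      (ε : EReal) * ENNReal.log (p ε x C) + ((⨅ y ∈ C, ρ x y : ℝ≥0∞) : EReal) ≤ (η : EReal))

/-- Hypothesis 2.5: absorption is not too unlikely near the absorbing set. -/
def HypAbs (p : ℝ → Kernel (Fin d → ℝ) (Fin d → ℝ)) (M M0 : Set (Fin d → ℝ)) : Prop :=
  ∀ c > (0 : ℝ), ∃ V0 : Set (Fin d → ℝ), IsOpen V0 ∧ M0 ⊆ V0 ∧
    (-(c : EReal)) ≤
      Filter.liminf (fun ε : ℝ => ⨅ x ∈ V0 ∩ M, (ε : EReal) * ENNReal.log (p ε x M0))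
        (𝓝[>] (0 : ℝ))

/-- The (topological) support of a measure. -/
def measSupport (μ : Measure (Fin d → ℝ)) : Set (Fin d → ℝ) :=
  {x | ∀ U : Set (Fin d → ℝ), IsOpen U → x ∈ U → 0 < μ U}

theorem apLe_trans' {F : (Fin d → ℝ) → Fin d → ℝ} {M M0 : Set (Fin d → ℝ)}
    {x y z : Fin d → ℝ} (h1 : apLe F M M0 x y) (h2 : apLe F M M0 y z) : apLe F M M0 x z := by
  intro δ hδ
  obtain ⟨n, ξ, ⟨hn, hM, h0, hd⟩, hs, he⟩ := h1 δ hδ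
  obtain ⟨m, ζ, ⟨hm, hM', h0', hd'⟩, hs', he'⟩ := h2 δ hδ
  have key : ∀ i, n ≤ i → (if i ≤ n then ξ i else ζ (i - n)) = ζ (i - n) := by
    intro i hi
    split_ifs with h
    · have : i = n := le_antisymm h hi
      subst this
      simp [he, hs']
    · rfl
  have key2 : ∀ i, i ≤ n → (if i ≤ n then ξ i else ζ (i - n)) = ξ i := by
    intro i hi
    simp [hi]
  refine ⟨n + m, fun i => if i ≤ n then ξ i else ζ (i - n), ⟨by omega, ?_, ?_, ?_⟩, ?_, ?_⟩
  · intro i hi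
    rcases le_total i n with h | h
    · simp only [key2 i h]; exact hM i h
    · simp only [key i h]; exact hM' _ (by omega)
  · intro i hi
    rcases lt_or_ge i n with h | h
    · simp only [key2 i h.le, key2 (i+1) h]; exact h0 i h
    · have e : i + 1 - n = (i - n) + 1 := by omega
      have := h0' (i - n) (by omega)
      beta_reduce
      rw [key i h, key (i + 1) (by omega), e]
      exact this
  · intro i hi
    rcases lt_or_ge i n with h | h
    · simp only [key2 i h.le, key2 (i+1) h]; exact hd i h
    · have e : i + 1 - n = (i - n) + 1 := by omega
      have := hd' (i - n) (by omega)
      beta_reduce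
      rw [key i h, key (i + 1) (by omega), e]
      exact this
  · simpa using hs
  · simp only [key (n+m) (by omega)]; simpa using he'

theorem stmt2 (d : ℕ) (M M0 : Set (Fin d → ℝ)) (F : (Fin d → ℝ) → Fin d → ℝ)
    (hMcl : IsClosed M) (hM0cl : IsClosed M0) (hM0M : M0 ⊆ M)
    (hFmap : MapsTo F M M) (hFcont : ContinuousOn F M)
    (hFbdd : ∃ C : ℝ, ∀ x ∈ M, ‖F x‖ ≤ C)
    (hFM0 : MapsTo F M0 M0) (hFM1 : MapsTo F (M \ M0) (M \ M0))
    (x : Fin d → ℝ) (hx : x ∈ apRec F M M0) (hxM1 : x ∈ M \ M0) :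
    closure (apClass F M M0 x) ⊆ M0 ∪ apClass F M M0 x ∧
    (closure (apClass F M M0 x) ⊆ M \ M0 → IsClosed (apClass F M M0 x)) := by
  have main : closure (apClass F M M0 x) ⊆ M0 ∪ apClass F M M0 x := by
    intro y hy
    by_cases hy0 : y ∈ M0
    · exact Or.inl hy0
    right
    have hsub : apClass F M M0 x ⊆ M := by
      rintro z ⟨-, -, h⟩
      obtain ⟨n, ξ, ⟨hn, hM, -, -⟩, hs, -⟩ := h 1 one_pos
      exact hs ▸ hM 0 (Nat.zero_le _)
    have hyM : y ∈ M := closure_minimal hsub hMcl hy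
    have hfr : ∃ᶠ z in 𝓝 y, z ∈ apClass F M M0 x := mem_closure_iff_frequently.1 hy
    have hev0 : ∀ᶠ z in 𝓝 y, z ∉ M0 := hM0cl.isOpen_compl.mem_nhds hy0
    have hxy : apLe F M M0 x y := by
      intro δ hδ
      have hev : ∀ᶠ z in 𝓝 y, dist z y < δ / 2 := Metric.ball_mem_nhds y (half_pos hδ)
      obtain ⟨z, hz, hz0, hzd⟩ := (hfr.and_eventually (hev0.and hev)).exists
      obtain ⟨n, ξ, ⟨hn, hM, h0, hd⟩, hs, he⟩ := hz.2.1 (δ / 2) (half_pos hδ)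
      refine ⟨n, Function.update ξ n y, ⟨hn, ?_, ?_, ?_⟩, ?_, by simp⟩
      · intro i hi
        by_cases h : i = n
        · simpa [h] using hyM
        · simpa [h] using hM i hi
      · intro i hi
        have h1 : i ≠ n := hi.ne
        by_cases h : i + 1 = n
        · intro h2
          rw [Function.update_of_ne h1] at h2
          have h3 := h0 i hi h2
          rw [h, he] at h3
          exact absurd h3 hz0
        · rw [Function.update_of_ne h1, Function.update_of_ne h]
          exact h0 i hi
      · intro i hi
        have h1 : i ≠ n := hi.ne
        have h3 := hd i hi
        rw [Function.update_of_ne h1]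
        by_cases h : i + 1 = n
        · rw [h, he] at h3
          rw [h, Function.update_self]
          have := dist_triangle_left y (F (ξ i)) z
          linarith
        · rw [Function.update_of_ne h]
          linarith
      · rw [Function.update_of_ne (by omega)]
        exact hs
    have hyx : apLe F M M0 y x := by
      intro δ hδ
      have hc := hFcont y hyM
      have hev : ∀ᶠ z in 𝓝 y, z ∈ M → dist (F z) (F y) < δ / 2 :=
        eventually_nhdsWithin_iff.1 (hc (Metric.ball_mem_nhds (F y) (half_pos hδ)))
      obtain ⟨z, hz, hz0, hzd⟩ := (hfr.and_eventually (hev0.and hev)).exists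
      have hzd := hzd (hsub hz)
      obtain ⟨n, ξ, ⟨hn, hM, h0, hd⟩, hs, he⟩ := hz.2.2 (δ / 2) (half_pos hδ)
      refine ⟨n, Function.update ξ 0 y, ⟨hn, ?_, ?_, ?_⟩, by simp, ?_⟩
      · intro i hi
        by_cases h : i = 0
        · simpa [h] using hyM
        · simpa [h] using hM i hi
      · intro i hi
        rw [Function.update_of_ne (Nat.succ_ne_zero i)]
        by_cases h : i = 0
        · intro h2
          rw [h, Function.update_self] at h2
          exact absurd h2 hy0
        · rw [Function.update_of_ne h]
          exact h0 i hi
      · intro i hi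
        have h3 := hd i hi
        rw [Function.update_of_ne (Nat.succ_ne_zero i)]
        by_cases h : i = 0
        · subst h
          rw [hs] at h3
          rw [Function.update_self]
          have := dist_triangle (ξ (0 + 1)) (F z) (F y)
          linarith
        · rw [Function.update_of_ne h]
          linarith
      · rw [Function.update_of_ne (by omega)]
        exact he
    have hyy := apLe_trans' hyx hxy
    exact ⟨⟨hyy, hyy⟩, hxy, hyx⟩
  refine ⟨main, fun h => isClosed_of_closure_subset fun y hy => ?_⟩
  exact (main hy).resolve_left (h hy).2

end QSDPaper
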